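/- Fix n ≥ 1 and 1 ≤ k ≤ 1+n, and let ω be a smooth k-form field on an open set W ⊆ ℝ^{1+n} with the flat Minkowski metric η. Define the energy tensor field T_{ab} := ((−1)^{k−1}/(k−1)!) ( ω_a{}^{i₂…i_k} ω_{b i₂…i_k} − (1/(2k)) ω^{i₁…i_k} ω_{i₁…i_k} η_{ab} ). Then the divergence of T equals i_ω dω − i_{∂ω} ω: for every index b and every point of W, Σ_{a=0}^{n} ε_a ∂_a T_{ab} = (i_ω dω)_b − (i_{∂ω} ω)_b. In particular, if dω = 0 and ∂ω = 0 then Σ_a ε_a ∂_a T_{ab} = 0 for every b. -/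

import Mathlib

namespace Paper

noncomputable section

/-- Points of `ℝ^{1+n}`. -/
abbrev Pt (n : ℕ) := Fin (n + 1) → ℝ

/-- Partial derivative `∂_a f` of a scalar function. -/
def pd (n : ℕ) (a : Fin (n + 1)) (f : Pt n → ℝ) (x : Pt n) : ℝ :=
  fderiv ℝ f x (Pi.single a 1)

/-- The signs `ε₀ = 1`, `ε_i = -1` for `i ≠ 0`. -/
def eps (n : ℕ) (i : Fin (n + 1)) : ℝ := if i = 0 then 1 else -1

/-- The flat Minkowski metric `η_{ab} = ε_a δ_{ab}`. -/
def etaM (n : ℕ) (a b : Fin (n + 1)) : ℝ := if a = b then eps n a else 0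

/-- Prepend an entry to an index tuple: `(a, v₁, …, v_{k-1})`. -/
def dcons {α : Type*} (k : ℕ) (a : α) (v : Fin (k - 1) → α) : Fin k → α :=
  fun j => if h : (j : ℕ) = 0 then a else v ⟨(j : ℕ) - 1, by have := j.isLt; omega⟩

/-- Append an entry to an index tuple: `(v₁, …, v_{k-1}, b)`. -/
def dsnoc {α : Type*} (k : ℕ) (v : Fin (k - 1) → α) (b : α) : Fin k → α :=
  fun j => if h : (j : ℕ) < k - 1 then v ⟨(j : ℕ), h⟩ else b

/-- The tail `(w₂, …, w_k)` of an index tuple. -/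
def dtail {α : Type*} (k : ℕ) (w : Fin k → α) : Fin (k - 1) → α :=
  fun j => w ⟨(j : ℕ) + 1, by have := j.isLt; omega⟩

/-- `ω` is a smooth `k`-form field on `W`: smooth antisymmetric components. -/
def IsFormFieldOn (n k : ℕ) (W : Set (Pt n)) (ω : Pt n → (Fin k → Fin (n + 1)) → ℝ) : Prop :=
  (∀ v, ContDiffOn ℝ (⊤ : ℕ∞) (fun x => ω x v) W) ∧
  (∀ x ∈ W, ∀ (v : Fin k → Fin (n + 1)) (σ : Equiv.Perm (Fin k)),
    ω x (v ∘ σ) = ((Equiv.Perm.sign σ : ℤ) : ℝ) * ω x v)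

/-- The exterior differential: `(dω)_{i₀…i_k} = Σ_j (−1)^j ∂_{i_j} ω_{i₀…î_j…i_k}`. -/
def dflat (n k : ℕ) (ω : Pt n → (Fin k → Fin (n + 1)) → ℝ) (x : Pt n)
    (u : Fin (k + 1) → Fin (n + 1)) : ℝ :=
  ∑ j : Fin (k + 1), (-1 : ℝ) ^ (j : ℕ) * pd n (u j) (fun y => ω y (u ∘ j.succAbove)) x

/-- The codifferential: `(∂ω)_{i₁…i_{k−1}} = −Σ_a ε_a ∂_a ω_{a i₁…i_{k−1}}`. -/
def cdflat (n k : ℕ) (ω : Pt n → (Fin k → Fin (n + 1)) → ℝ) (x : Pt n)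
    (v : Fin (k - 1) → Fin (n + 1)) : ℝ :=
  -∑ a, eps n a * pd n a (fun y => ω y (dcons k a v)) x

/-- `(i_{∂ω}ω)_b = (1/(k−1)!) (∂ω)^{i₂…i_k} ω_{i₂…i_k b}` (indices raised with `η`). -/
def icd (n k : ℕ) (ω : Pt n → (Fin k → Fin (n + 1)) → ℝ) (x : Pt n) (b : Fin (n + 1)) : ℝ :=
  (1 / ((k - 1).factorial : ℝ)) * ∑ v : Fin (k - 1) → Fin (n + 1),
    (∏ j, eps n (v j)) * cdflat n k ω x v * ω x (dsnoc k v b)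

/-- `(i_ω dω)_b = (1/k!) ω^{i₁…i_k} (dω)_{i₁…i_k b}` (indices raised with `η`). -/
def iwd (n k : ℕ) (ω : Pt n → (Fin k → Fin (n + 1)) → ℝ) (x : Pt n) (b : Fin (n + 1)) : ℝ :=
  (1 / (k.factorial : ℝ)) * ∑ v : Fin k → Fin (n + 1),
    (∏ j, eps n (v j)) * ω x v * dflat n k ω x (dsnoc (k + 1) v b)

/-- The scalar square `⟨ω,ω⟩ = (1/k!) ω^{i₁…i_k} ω_{i₁…i_k}`. -/
def sqn (n k : ℕ) (ω : Pt n → (Fin k → Fin (n + 1)) → ℝ) (x : Pt n) : ℝ :=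
  (1 / (k.factorial : ℝ)) * ∑ v : Fin k → Fin (n + 1),
    (∏ j, eps n (v j)) * ω x v * ω x v

/-- The energy tensor field
`T_{ab} = ((−1)^{k−1}/(k−1)!)(ω_a{}^{i₂…i_k} ω_{b i₂…i_k} − (1/(2k)) ω^{i₁…i_k}ω_{i₁…i_k} η_{ab})`. -/
def Tflat (n k : ℕ) (ω : Pt n → (Fin k → Fin (n + 1)) → ℝ) (x : Pt n)
    (a b : Fin (n + 1)) : ℝ :=
  ((-1 : ℝ) ^ (k - 1) / ((k - 1).factorial : ℝ)) *
    ((∑ v : Fin (k - 1) → Fin (n + 1),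
        (∏ j, eps n (v j)) * ω x (dcons k a v) * ω x (dcons k b v))
      - (1 / (2 * (k : ℝ))) * (∑ w : Fin k → Fin (n + 1),
        (∏ j, eps n (w j)) * ω x w * ω x w) * etaM n a b)

/-- The tensor field `S_{ab} = (1/(k−1)!) ω_a{}^{i₂…i_k} ω_{b i₂…i_k}`,
the components of `⟨i_−ω, i_−ω⟩`. -/
def Sflat (n k : ℕ) (ω : Pt n → (Fin k → Fin (n + 1)) → ℝ) (x : Pt n)
    (a b : Fin (n + 1)) : ℝ :=
  (1 / ((k - 1).factorial : ℝ)) * ∑ v : Fin (k - 1) → Fin (n + 1),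
    (∏ j, eps n (v j)) * ω x (dcons k a v) * ω x (dcons k b v)

/-- The volume form `dX` on index tuples: `dX(e_{u₀},…,e_{u_n})`. -/
def dXc (n : ℕ) (u : Fin (n + 1) → Fin (n + 1)) : ℝ :=
  Matrix.det (Matrix.of fun i j => if u i = j then (1 : ℝ) else 0)

end

end Paper

namespace Paper

theorem dcons_succ {α : Type*} (m : ℕ) (a : α) (v : Fin m → α) :
    dcons (m + 1) a v = (Fin.cons a v : Fin (m + 1) → α) := by
  funext j
  refine Fin.cases ?_ (fun i => ?_) j <;> simp [dcons]

theorem dsnoc_succ {α : Type*} (m : ℕ) (v : Fin m → α) (b : α) :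
    dsnoc (m + 1) v b = (Fin.snoc v b : Fin (m + 1) → α) := by
  funext j
  refine Fin.lastCases ?_ (fun i => ?_) j <;> simp [dsnoc]

theorem snoc_insertNth_comp_succAbove {α : Type*} {m : ℕ} (j : Fin (m + 1)) (a b : α)
    (v : Fin m → α) :
    (Fin.snoc (j.insertNth a v : Fin (m + 1) → α) b : Fin (m + 2) → α) ∘ j.castSucc.succAbove
      = (Fin.snoc v b : Fin (m + 1) → α) := by
  funext i
  refine Fin.lastCases ?_ (fun i => ?_) i
  · simp
  · simp [Fin.castSucc_succAbove_castSucc]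

theorem eps_mul_self (n : ℕ) (a : Fin (n + 1)) : eps n a * eps n a = 1 := by
  unfold eps
  split_ifs <;> norm_num

section Derivatives

variable {n : ℕ} {a : Fin (n + 1)} {x : Pt n} {f g : Pt n → ℝ}

theorem pd_congr (h : f =ᶠ[nhds x] g) : pd n a f x = pd n a g x := by
  simp only [pd, h.fderiv_eq]

theorem pd_mul (hf : DifferentiableAt ℝ f x) (hg : DifferentiableAt ℝ g x) :
    pd n a (fun y => f y * g y) x = pd n a f x * g x + f x * pd n a g x := by
  simp only [pd, fderiv_fun_mul hf hg, add_apply, smul_apply, smul_eq_mul]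
  ring

theorem pd_sub (hf : DifferentiableAt ℝ f x) (hg : DifferentiableAt ℝ g x) :
    pd n a (fun y => f y - g y) x = pd n a f x - pd n a g x := by
  simp only [pd, fderiv_fun_sub hf hg, sub_apply]

theorem pd_const_mul (c : ℝ) (hf : DifferentiableAt ℝ f x) :
    pd n a (fun y => c * f y) x = c * pd n a f x := by
  simp only [pd, fderiv_const_mul hf, smul_apply, smul_eq_mul]

theorem pd_sum {ι : Type*} [Fintype ι] {F : ι → Pt n → ℝ}
    (hF : ∀ i, DifferentiableAt ℝ (F i) x) :
    pd n a (fun y => ∑ i, F i y) x = ∑ i, pd n a (F i) x := by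
  simp only [pd, fderiv_fun_sum fun i _ => hF i, sum_apply]

end Derivatives

/-- A component function on index tuples is alternating if permuting the indices multiplies it
by the sign of the permutation. -/
def IsAlternating {α : Type*} {k : ℕ} (c : (Fin k → α) → ℝ) : Prop :=
  ∀ (v : Fin k → α) (σ : Equiv.Perm (Fin k)),
    c (v ∘ σ) = ((Equiv.Perm.sign σ : ℤ) : ℝ) * c v

theorem IsAlternating.insertNth {α : Type*} {m : ℕ} {c : (Fin (m + 1) → α) → ℝ}
    (hc : IsAlternating c) (j : Fin (m + 1)) (a : α) (v : Fin m → α) :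
    c (j.insertNth a v) = (-1) ^ (j : ℕ) * c (Fin.cons a v : Fin (m + 1) → α) := by
  rw [← Fin.cons_comp_cycleRange, hc, Fin.sign_cycleRange]
  simp

theorem IsAlternating.snoc {α : Type*} {m : ℕ} {c : (Fin (m + 1) → α) → ℝ}
    (hc : IsAlternating c) (a : α) (v : Fin m → α) :
    c (Fin.snoc v a : Fin (m + 1) → α) = (-1) ^ m * c (Fin.cons a v : Fin (m + 1) → α) := by
  rw [← Fin.insertNth_last', hc.insertNth, Fin.val_last]

theorem IsFormFieldOn.isAlternating {n k : ℕ} {W : Set (Pt n)}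
    {ω : Pt n → (Fin k → Fin (n + 1)) → ℝ} (hω : IsFormFieldOn n k W ω) {x : Pt n}
    (hx : x ∈ W) : IsAlternating (ω x) :=
  hω.2 x hx

theorem IsFormFieldOn.differentiableAt {n k : ℕ} {W : Set (Pt n)} (hW : IsOpen W)
    {ω : Pt n → (Fin k → Fin (n + 1)) → ℝ} (hω : IsFormFieldOn n k W ω) {x : Pt n}
    (hx : x ∈ W) (v : Fin k → Fin (n + 1)) : DifferentiableAt ℝ (fun y => ω y v) x :=
  ((hω.1 v).contDiffAt (hW.mem_nhds hx)).differentiableAt (by simp)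

theorem IsFormFieldOn.isAlternating_pd {n k : ℕ} {W : Set (Pt n)} (hW : IsOpen W)
    {ω : Pt n → (Fin k → Fin (n + 1)) → ℝ} (hω : IsFormFieldOn n k W ω) {x : Pt n}
    (hx : x ∈ W) (a : Fin (n + 1)) : IsAlternating fun v => pd n a (fun y => ω y v) x := by
  intro v σ
  simp only
  rw [← pd_const_mul _ (hω.differentiableAt hW hx v)]
  exact pd_congr (Filter.eventually_of_mem (hW.mem_nhds hx) fun y hy => hω.2 y hy v σ)

theorem sum_eq_sum_insertNth {α M : Type*} [Fintype α] [AddCommMonoid M] {m : ℕ}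
    (j : Fin (m + 1)) (F : (Fin (m + 1) → α) → M) :
    ∑ v, F v = ∑ a, ∑ v : Fin m → α, F (j.insertNth a v) := by
  rw [← Fintype.sum_prod_type', ← (Fin.insertNthEquiv (fun _ => α) j).sum_comp]
  rfl

/-- The divergence of the energy tensor, expanded by the product rule. -/
theorem div_Tflat {n m : ℕ} {ω : Pt n → (Fin (m + 1) → Fin (n + 1)) → ℝ} {x : Pt n}
    (hd : ∀ v, DifferentiableAt ℝ (fun y => ω y v) x) (b : Fin (n + 1)) :
    (∑ a, eps n a * pd n a (fun y => Tflat n (m + 1) ω y a b) x) =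
      (-1) ^ m / (m.factorial : ℝ) *
        ((∑ a, ∑ v : Fin m → Fin (n + 1), eps n a * ((∏ j, eps n (v j)) *
            (pd n a (fun y => ω y (Fin.cons a v)) x * ω x (Fin.cons b v))))
        + (∑ a, ∑ v : Fin m → Fin (n + 1), eps n a * ((∏ j, eps n (v j)) *
            (ω x (Fin.cons a v) * pd n a (fun y => ω y (Fin.cons b v)) x)))
        - 1 / ((m : ℝ) + 1) * ∑ w : Fin (m + 1) → Fin (n + 1),
            (∏ j, eps n (w j)) * (ω x w * pd n b (fun y => ω y w) x)) := by
  have key : ∀ a, pd n a (fun y => Tflat n (m + 1) ω y a b) x =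
      (-1) ^ m / (m.factorial : ℝ) *
        ((∑ v : Fin m → Fin (n + 1), (∏ j, eps n (v j)) *
            (pd n a (fun y => ω y (Fin.cons a v)) x * ω x (Fin.cons b v)))
        + (∑ v : Fin m → Fin (n + 1), (∏ j, eps n (v j)) *
            (ω x (Fin.cons a v) * pd n a (fun y => ω y (Fin.cons b v)) x))
        - etaM n a b * (1 / ((m : ℝ) + 1) * ∑ w : Fin (m + 1) → Fin (n + 1),
            (∏ j, eps n (w j)) * (ω x w * pd n a (fun y => ω y w) x))) := by
    intro a
    have hT : (fun y => Tflat n (m + 1) ω y a b) = fun y =>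
        (-1) ^ m / (m.factorial : ℝ) *
          ((∑ v : Fin m → Fin (n + 1), (∏ j, eps n (v j)) *
            (ω y (Fin.cons a v) * ω y (Fin.cons b v)))
          - (etaM n a b * (1 / (2 * ((m : ℝ) + 1)))) * ∑ w : Fin (m + 1) → Fin (n + 1),
            (∏ j, eps n (w j)) * (ω y w * ω y w)) := by
      funext y
      simp only [Tflat, Nat.add_sub_cancel, dcons_succ, Nat.cast_add, Nat.cast_one, mul_assoc]
      congr 2
      ring
    rw [hT, pd_const_mul _ (by fun_prop), pd_sub (by fun_prop) (by fun_prop),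
      pd_const_mul _ (by fun_prop), pd_sum (by fun_prop), pd_sum (by fun_prop)]
    have h₁ : ∀ (c : ℝ) (v w : Fin (m + 1) → Fin (n + 1)),
        pd n a (fun y => c * (ω y v * ω y w)) x =
          c * (pd n a (fun y => ω y v) x * ω x w + ω x v * pd n a (fun y => ω y w) x) :=
      fun c v w => by rw [pd_const_mul _ ((hd v).fun_mul (hd w)), pd_mul (hd v) (hd w)]
    have h₂ : ∀ w : Fin (m + 1) → Fin (n + 1),
        pd n a (fun y => (∏ j, eps n (w j)) * (ω y w * ω y w)) x =
          2 * ((∏ j, eps n (w j)) * (ω x w * pd n a (fun y => ω y w) x)) :=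
      fun w => by rw [h₁]; ring
    simp only [h₂, ← Finset.mul_sum]
    simp only [h₁, mul_add, Finset.sum_add_distrib]
    field_simp
  simp only [key, ← Finset.mul_sum]
  simp only [mul_left_comm (eps n _) ((-1) ^ m / (m.factorial : ℝ)), ← Finset.mul_sum]
  simp only [mul_add, mul_sub, Finset.sum_add_distrib, Finset.sum_sub_distrib]
  congr 2
  simp only [etaM, ite_mul, zero_mul, mul_ite, mul_zero, Finset.sum_ite_eq', Finset.mem_univ,
    if_true]
  rw [← mul_assoc (eps n b), eps_mul_self, one_mul]

theorem icd_succ {n m : ℕ} {ω : Pt n → (Fin (m + 1) → Fin (n + 1)) → ℝ} {x : Pt n}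
    (hω : IsAlternating (ω x)) (b : Fin (n + 1)) :
    icd n (m + 1) ω x b = -((-1) ^ m / (m.factorial : ℝ) *
      ∑ a, ∑ v : Fin m → Fin (n + 1), eps n a * ((∏ j, eps n (v j)) *
        (pd n a (fun y => ω y (Fin.cons a v)) x * ω x (Fin.cons b v)))) := by
  rw [Finset.sum_comm]
  have h : icd n (m + 1) ω x b = 1 / (m.factorial : ℝ) * ∑ v : Fin m → Fin (n + 1),
      (∏ j, eps n (v j)) * cdflat n (m + 1) ω x v * ω x (dsnoc (m + 1) v b) := rfl
  simp only [h, cdflat, dcons_succ, dsnoc_succ, hω.snoc]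
  rw [Finset.mul_sum, Finset.mul_sum, ← Finset.sum_neg_distrib]
  refine Finset.sum_congr rfl fun v _ => ?_
  rw [mul_neg, neg_mul, mul_neg, Finset.mul_sum, Finset.sum_mul, Finset.mul_sum, Finset.mul_sum]
  congr 1
  refine Finset.sum_congr rfl fun a _ => ?_
  ring

theorem iwd_succ {n m : ℕ} {ω : Pt n → (Fin (m + 1) → Fin (n + 1)) → ℝ} {x : Pt n}
    (hω : IsAlternating (ω x))
    (hD : ∀ a, IsAlternating fun v => pd n a (fun y => ω y v) x) (b : Fin (n + 1)) :
    iwd n (m + 1) ω x b = (-1) ^ m / (m.factorial : ℝ) *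
      ((∑ a, ∑ v : Fin m → Fin (n + 1), eps n a * ((∏ j, eps n (v j)) *
            (ω x (Fin.cons a v) * pd n a (fun y => ω y (Fin.cons b v)) x)))
        - 1 / ((m : ℝ) + 1) * ∑ w : Fin (m + 1) → Fin (n + 1),
            (∏ j, eps n (w j)) * (ω x w * pd n b (fun y => ω y w) x)) := by
  have hlast : ∀ v : Fin (m + 1) → Fin (n + 1),
      (Fin.snoc v b : Fin (m + 2) → Fin (n + 1)) ∘ (Fin.last (m + 1)).succAbove = v := by
    intro v
    funext i
    simp
  have hj : ∀ j : Fin (m + 1),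
      (∑ v : Fin (m + 1) → Fin (n + 1), (∏ j, eps n (v j)) * ω x v *
        ((-1) ^ (j : ℕ) * pd n (v j) (fun y => ω y
          ((Fin.snoc v b : Fin (m + 2) → Fin (n + 1)) ∘ j.castSucc.succAbove)) x)) =
      (-1) ^ m * ∑ a, ∑ v : Fin m → Fin (n + 1), eps n a * ((∏ j, eps n (v j)) *
            (ω x (Fin.cons a v) * pd n a (fun y => ω y (Fin.cons b v)) x)) := by
    intro j
    rw [sum_eq_sum_insertNth j]
    simp only [Finset.mul_sum]
    refine Finset.sum_congr rfl fun a _ => Finset.sum_congr rfl fun v _ => ?_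
    have hs : ((-1 : ℝ) ^ (j : ℕ)) * (-1) ^ (j : ℕ) = 1 := by
      rw [← mul_pow]; simp
    rw [snoc_insertNth_comp_succAbove, (hD _).snoc, hω.insertNth, Fin.prod_univ_succAbove _ j]
    simp only [Fin.insertNth_apply_same, Fin.insertNth_apply_succAbove]
    linear_combination (eps n a * (∏ j, eps n (v j)) * ω x (Fin.cons a v) * (-1) ^ m *
      pd n a (fun y => ω y (Fin.cons b v)) x) * hs
  have hfac : ((m + 1).factorial : ℝ) = ((m : ℝ) + 1) * m.factorial := by
    push_cast [Nat.factorial_succ]; ring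
  have hm : (m.factorial : ℝ) ≠ 0 := by positivity
  have hm' : (m : ℝ) + 1 ≠ 0 := by positivity
  simp only [iwd, dflat, dsnoc_succ (m + 1), Fin.sum_univ_castSucc (n := m + 1),
    Fin.snoc_castSucc, Fin.snoc_last, Fin.val_castSucc, Fin.val_last, hlast, mul_add,
    Finset.sum_add_distrib]
  simp only [Finset.mul_sum (s := (Finset.univ : Finset (Fin (m + 1))))]
  rw [Finset.sum_comm]
  simp only [hj, Finset.sum_const, Finset.card_univ, Fintype.card_fin, nsmul_eq_mul]
  have hl : (∑ v : Fin (m + 1) → Fin (n + 1), (∏ j, eps n (v j)) * ω x v *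
      ((-1) ^ (m + 1) * pd n b (fun y => ω y v) x)) =
      (-1) ^ (m + 1) * ∑ w : Fin (m + 1) → Fin (n + 1),
            (∏ j, eps n (w j)) * (ω x w * pd n b (fun y => ω y w) x) := by
    rw [Finset.mul_sum]
    exact Finset.sum_congr rfl fun w _ => by ring
  rw [hl, hfac]
  push_cast
  field_simp
  ring

/-- `div T = i_ω dω − i_{∂ω}ω`; in particular `div T = 0` for a closed and
co-closed form. -/
theorem statement15 (n k : ℕ) (hn : 1 ≤ n) (hk1 : 1 ≤ k) (hk2 : k ≤ n + 1)
    (W : Set (Pt n)) (hW : IsOpen W)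
    (ω : Pt n → (Fin k → Fin (n + 1)) → ℝ) (hω : IsFormFieldOn n k W ω) :
    (∀ x ∈ W, ∀ b : Fin (n + 1),
      (∑ a, eps n a * pd n a (fun y => Tflat n k ω y a b) x)
        = iwd n k ω x b - icd n k ω x b) ∧
    ((∀ x ∈ W, ∀ u : Fin (k + 1) → Fin (n + 1), dflat n k ω x u = 0) →
     (∀ x ∈ W, ∀ v : Fin (k - 1) → Fin (n + 1), cdflat n k ω x v = 0) →
      ∀ x ∈ W, ∀ b : Fin (n + 1),
        (∑ a, eps n a * pd n a (fun y => Tflat n k ω y a b) x) = 0) := by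
  have main : ∀ x ∈ W, ∀ b : Fin (n + 1),
      (∑ a, eps n a * pd n a (fun y => Tflat n k ω y a b) x)
        = iwd n k ω x b - icd n k ω x b := by
    intro x hx b
    obtain ⟨m, rfl⟩ := Nat.exists_eq_add_of_le' hk1
    rw [div_Tflat (hω.differentiableAt hW hx), icd_succ (hω.isAlternating hx),
      iwd_succ (hω.isAlternating hx) (hω.isAlternating_pd hW hx)]
    ring
  refine ⟨main, fun hd hcd x hx b => ?_⟩
  rw [main x hx b]
  simp [iwd, icd, hd x hx, hcd x hx]

end Paper
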